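/- (Main theorem, helpers present: counter-example.) For the XOR counter-example source with active set A = {1, 2, 3} (a strict subset of M, so terminals 4, 5, 6 are helpers), the mutual dependence upper bound is not tight: C_SK(A) < I(A) with strict inequality, where C_SK(A) := h(M) − R_CO(A). -/

import Mathlib

open Finset

/-- Marginal pmf of `p` on the coordinates in `S`. -/
noncomputable def marg {m : ℕ} {𝒳 : Fin m → Type} [∀ i, Fintype (𝒳 i)]
    [∀ i, DecidableEq (𝒳 i)] (p : (∀ i, 𝒳 i) → ℝ) (S : Finset (Fin m))
    (y : ∀ i : {j // j ∈ S}, 𝒳 i.1) : ℝ :=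
  ∑ x : ∀ i, 𝒳 i, if ∀ i : {j // j ∈ S}, x i.1 = y i then p x else 0

/-- Shannon entropy (base 2) of the coordinates in `S`. -/
noncomputable def Hent {m : ℕ} {𝒳 : Fin m → Type} [∀ i, Fintype (𝒳 i)]
    [∀ i, DecidableEq (𝒳 i)] (p : (∀ i, 𝒳 i) → ℝ) (S : Finset (Fin m)) : ℝ :=
  -∑ y : ∀ i : {j // j ∈ S}, 𝒳 i.1, marg p S y * Real.logb 2 (marg p S y)

/-- The conditional entropy function `h(B) = H(X_M) - H(X_{Bᶜ}) = H(X_B | X_{Bᶜ})`. -/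
noncomputable def condh {m : ℕ} {𝒳 : Fin m → Type} [∀ i, Fintype (𝒳 i)]
    [∀ i, DecidableEq (𝒳 i)] (p : (∀ i, 𝒳 i) → ℝ) (B : Finset (Fin m)) : ℝ :=
  Hent p Finset.univ - Hent p Bᶜ

/-- Conditional entropy `H(X_S | X_U) = H(X_{S ∪ U}) - H(X_U)`. -/
noncomputable def condEnt {m : ℕ} {𝒳 : Fin m → Type} [∀ i, Fintype (𝒳 i)]
    [∀ i, DecidableEq (𝒳 i)] (p : (∀ i, 𝒳 i) → ℝ) (S U : Finset (Fin m)) : ℝ :=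
  Hent p (S ∪ U) - Hent p U

/-- `B ∈ ℬ(A)`: `B` is a nonempty proper subset of `M` not containing `A`. -/
def memB {m : ℕ} (A B : Finset (Fin m)) : Prop :=
  B.Nonempty ∧ B ⊂ Finset.univ ∧ ¬ A ⊆ B

/-- `R ∈ ℛ(A)`: the rate tuple `R` satisfies all Slepian–Wolf constraints for `A`. -/
def feasible {m : ℕ} {𝒳 : Fin m → Type} [∀ i, Fintype (𝒳 i)]
    [∀ i, DecidableEq (𝒳 i)] (p : (∀ i, 𝒳 i) → ℝ) (A : Finset (Fin m))
    (R : Fin m → ℝ) : Prop :=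
  ∀ B : Finset (Fin m), memB A B → condh p B ≤ ∑ j ∈ B, R j

/-- Smallest rate of communication for omniscience `R_CO(A)`. -/
noncomputable def RCO {m : ℕ} {𝒳 : Fin m → Type} [∀ i, Fintype (𝒳 i)]
    [∀ i, DecidableEq (𝒳 i)] (p : (∀ i, 𝒳 i) → ℝ) (A : Finset (Fin m)) : ℝ :=
  sInf {s : ℝ | ∃ R : Fin m → ℝ, feasible p A R ∧ s = ∑ j, R j}

/-- `(C 1, …, C k)` is a partition of `M` into pairwise disjoint sets. -/
def isPartition {m k : ℕ} (C : Fin k → Finset (Fin m)) : Prop :=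
  (∀ i j, i ≠ j → Disjoint (C i) (C j)) ∧ Finset.univ.biUnion C = Finset.univ

/-- Mutual dependence `I(C_1,…,C_k)` of the partitioning `C`. -/
noncomputable def Ival {m : ℕ} {𝒳 : Fin m → Type} [∀ i, Fintype (𝒳 i)]
    [∀ i, DecidableEq (𝒳 i)] (p : (∀ i, 𝒳 i) → ℝ) {k : ℕ}
    (C : Fin k → Finset (Fin m)) : ℝ :=
  ((∑ i, Hent p (C i)) - Hent p Finset.univ) / ((k : ℝ) - 1)

/-- Mutual dependence upper bound `I(A)`: minimum of `I(C_1,…,C_k)` over all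
`2 ≤ k ≤ |A|` and partitionings in `𝒫_k(A)`. -/
noncomputable def IA {m : ℕ} {𝒳 : Fin m → Type} [∀ i, Fintype (𝒳 i)]
    [∀ i, DecidableEq (𝒳 i)] (p : (∀ i, 𝒳 i) → ℝ) (A : Finset (Fin m)) : ℝ :=
  sInf {r : ℝ | ∃ k : ℕ, 2 ≤ k ∧ k ≤ A.card ∧ ∃ C : Fin k → Finset (Fin m),
    isPartition C ∧ (∀ i, (C i ∩ A).Nonempty) ∧ r = Ival p C}

/-- The XOR map defining the counter-example source: `X_1 = Y_1 ⊕ Y_3`,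
`X_2 = Y_1 ⊕ Y_4`, `X_3 = Y_3 ⊕ Y_4`, `X_4 = Y_2 ⊕ Y_3`, `X_5 = Y_2 ⊕ Y_4`,
`X_6 = Y_1 ⊕ Y_2` (indices shifted to start from `0`). -/
def xorMap (y : Fin 4 → ZMod 2) : Fin 6 → ZMod 2 :=
  ![y 0 + y 2, y 0 + y 3, y 2 + y 3, y 1 + y 2, y 1 + y 3, y 0 + y 1]

/-- The joint pmf of the counter-example source: the pushforward under `xorMap`
of the uniform distribution on `𝔽₂⁴`. -/
noncomputable def xorP (x : Fin 6 → ZMod 2) : ℝ :=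
  ((Finset.univ.filter (fun y : Fin 4 → ZMod 2 => xorMap y = x)).card : ℝ) / 16

/-- The number of seeds `w` on which all the coordinates of `xorMap w` in `S` vanish. -/
def kerCard (S : Finset (Fin 6)) : ℕ :=
  (univ.filter (fun w : Fin 4 → ZMod 2 => ∀ i ∈ S, xorMap w i = 0)).card

lemma xorMap_add (v w : Fin 4 → ZMod 2) : xorMap (v + w) = xorMap v + xorMap w := by
  funext i
  fin_cases i <;> simp [xorMap] <;> ring

lemma xorMap_sub (v w : Fin 4 → ZMod 2) : xorMap (v - w) = xorMap v - xorMap w := by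
  rw [eq_sub_iff_add_eq, ← xorMap_add, sub_add_cancel]

lemma marg_xorP (S : Finset (Fin 6)) (y : {j // j ∈ S} → ZMod 2) :
    marg xorP S y =
      ∑ w : Fin 4 → ZMod 2,
        if (fun i : {j // j ∈ S} => xorMap w i) = y then (1 : ℝ) / 16 else 0 := by
  have h : ∀ x : Fin 6 → ZMod 2,
      (if ∀ i : {j // j ∈ S}, x i.1 = y i then xorP x else 0) =
        ∑ w : Fin 4 → ZMod 2, if xorMap w = x then
          (if (fun i : {j // j ∈ S} => xorMap w i) = y then (1 : ℝ) / 16 else 0) else 0 := by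
    intro x
    rw [← sum_filter]
    rw [sum_congr rfl (g := fun _ => if ∀ i : {j // j ∈ S}, x i.1 = y i then (1 : ℝ) / 16 else 0)]
    · rw [sum_const, nsmul_eq_mul]
      split_ifs
      · rw [xorP, mul_one_div]
      · rw [mul_zero]
    · intro w hw
      simp only [mem_filter, mem_univ, true_and] at hw
      simp only [funext_iff, hw]
  unfold marg
  rw [sum_congr rfl fun x _ => h x, sum_comm]
  simp

lemma marg_xorP_xorMap (S : Finset (Fin 6)) (w : Fin 4 → ZMod 2) :
    marg xorP S (fun i => xorMap w i) = (kerCard S : ℝ) / 16 := by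
  rw [marg_xorP, ← sum_filter, sum_const, nsmul_eq_mul, mul_one_div]
  congr 2
  refine card_bij' (fun v _ => v - w) (fun v _ => v + w) ?_ ?_ ?_ ?_
  · intro v hv
    simpa [xorMap_sub, funext_iff, sub_eq_zero] using hv
  · intro v hv
    simpa [xorMap_add, funext_iff] using hv
  · simp
  · simp

lemma Hent_xorP (S : Finset (Fin 6)) : Hent xorP S = 4 - Real.logb 2 (kerCard S) := by
  have hpos : 0 < kerCard S :=
    card_pos.2 ⟨0, by
      simp only [mem_filter, mem_univ, true_and]
      intro i _
      fin_cases i <;> simp [xorMap]⟩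
  have h16 : Real.logb 2 16 = 4 := by
    rw [show (16 : ℝ) = 2 ^ (4 : ℕ) by norm_num, Real.logb_pow]
    simp
  have h : ∑ y : {j // j ∈ S} → ZMod 2, marg xorP S y * Real.logb 2 (marg xorP S y) =
      ∑ w : Fin 4 → ZMod 2, (1 : ℝ) / 16 * Real.logb 2 (kerCard S / 16) := by
    calc
      _ = ∑ y : {j // j ∈ S} → ZMod 2, ∑ w : Fin 4 → ZMod 2,
          if (fun i : {j // j ∈ S} => xorMap w i) = y then
            (1 : ℝ) / 16 * Real.logb 2 (marg xorP S y) else 0 := by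
        refine sum_congr rfl fun y _ => ?_
        conv_lhs => rw [marg_xorP S y, sum_mul, ← marg_xorP S y]
        simp only [ite_mul, zero_mul]
      _ = _ := by
        rw [sum_comm]
        refine sum_congr rfl fun w _ => ?_
        rw [sum_ite_eq, if_pos (mem_univ _), marg_xorP_xorMap]
  rw [Hent, h, Real.logb_div (by exact_mod_cast hpos.ne') (by norm_num), h16]
  simp

lemma Hent_xorP_eq {S : Finset (Fin 6)} {r n : ℕ} (h : kerCard S = 2 ^ n) (hr : n + r = 4) :
    Hent xorP S = r := by
  have hr' : (n : ℝ) + r = 4 := by exact_mod_cast hr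
  rw [Hent_xorP, h, Nat.cast_pow, Real.logb_pow]
  simp
  linarith

lemma kerCard_eq_two_pow : ∀ S : Finset (Fin 6), ∃ n : Fin 5,
    kerCard S = 2 ^ (n : ℕ) ∧ n + min (S.card) 2 ≤ 4 ∧ (4 ≤ S.card → (n : ℕ) ≤ 1) := by
  decide +kernel

/-- The entropy of a set of XOR coordinates is a natural number, bounded below in terms of the
cardinality of the set. -/
lemma exists_Hent_xorP_eq (S : Finset (Fin 6)) :
    ∃ r : ℕ, Hent xorP S = r ∧ min S.card 2 ≤ r ∧ (4 ≤ S.card → 3 ≤ r) := by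
  obtain ⟨n, hn, h2, h4⟩ := kerCard_eq_two_pow S
  exact ⟨4 - n, Hent_xorP_eq hn (by omega), by omega, by omega⟩

lemma Hent_xorP_univ : Hent xorP (univ : Finset (Fin 6)) = 3 := by
  exact_mod_cast Hent_xorP_eq (n := 1) (r := 3) (by decide +kernel) rfl

lemma card_eq_sum_of_isPartition {m k : ℕ} {C : Fin k → Finset (Fin m)} (hC : isPartition C) :
    ∑ i, (C i).card = m := by
  rw [← card_biUnion fun i _ j _ hij => hC.1 i j hij, hC.2, card_univ, Fintype.card_fin]

lemma one_le_IA_xorP : 1 ≤ IA xorP ({0, 1, 2} : Finset (Fin 6)) := by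
  refine le_csInf ?_ ?_
  · refine ⟨_, 2, le_rfl, by decide, ![{0}, {0}ᶜ], ⟨by decide, by decide⟩, by decide, rfl⟩
  · rintro _ ⟨k, hk, hkA, C, hC, hCA, rfl⟩
    have hcard := card_eq_sum_of_isPartition hC
    have hne : ∀ i, 0 < (C i).card := fun i =>
      card_pos.2 ((hCA i).mono inter_subset_left)
    choose r hr h2 h4 using fun i => exists_Hent_xorP_eq (C i)
    have hk3 : k ≤ 3 := hkA
    rw [Ival, Hent_xorP_univ, sum_congr rfl fun i _ => hr i]
    interval_cases k
    · have a0 := hne 0; have a1 := hne 1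
      have b0 := h2 0; have b1 := h2 1
      have c0 := h4 0; have c1 := h4 1
      rw [Fin.sum_univ_two] at hcard ⊢
      have : 4 ≤ r 0 + r 1 := by omega
      have : (4 : ℝ) ≤ r 0 + r 1 := by exact_mod_cast this
      rw [le_div_iff₀ (by norm_num)]
      norm_num
      linarith
    · have a0 := hne 0; have a1 := hne 1; have a2 := hne 2
      have b0 := h2 0; have b1 := h2 1; have b2 := h2 2
      have c0 := h4 0; have c1 := h4 1; have c2 := h4 2
      rw [Fin.sum_univ_three] at hcard ⊢
      have : 5 ≤ r 0 + r 1 + r 2 := by omega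
      have : (5 : ℝ) ≤ r 0 + r 1 + r 2 := by exact_mod_cast this
      rw [le_div_iff₀ (by norm_num)]
      norm_num
      linarith

lemma memB_compl {A T : Finset (Fin 6)} (hT : T ≠ univ) (hA : (A ∩ T).Nonempty) :
    memB A Tᶜ := by
  obtain ⟨a, ha⟩ := hA
  rw [mem_inter] at ha
  refine ⟨?_, ?_, fun h => mem_compl.1 (h ha.1) ha.2⟩
  · rwa [nonempty_iff_ne_empty, ne_eq, compl_eq_empty_iff]
  · rw [ssubset_univ_iff, ne_eq, compl_eq_univ_iff]
    rintro rfl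
    exact notMem_empty _ ha.2

lemma le_sum_compl_of_feasible {R : Fin 6 → ℝ} (hR : feasible xorP {0, 1, 2} R)
    (T : Finset (Fin 6)) {r n : ℕ} (hT : T ≠ univ)
    (hA : (({0, 1, 2} : Finset (Fin 6)) ∩ T).Nonempty)
    (h : kerCard T = 2 ^ n) (hr : n + r = 4) : 3 - (r : ℝ) ≤ ∑ j, R j - ∑ j ∈ T, R j := by
  have := hR Tᶜ (memB_compl hT hA)
  rw [condh, compl_compl, Hent_xorP_univ, Hent_xorP_eq h hr] at this
  linarith [sum_add_sum_compl T R]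

lemma nine_fourths_le_RCO_xorP : 9 / 4 ≤ RCO xorP ({0, 1, 2} : Finset (Fin 6)) := by
  refine le_csInf ⟨_, fun _ => 3, ?_, rfl⟩ ?_
  · rintro B ⟨hB, -, -⟩
    obtain ⟨r, hr, -⟩ := exists_Hent_xorP_eq Bᶜ
    rw [condh, Hent_xorP_univ, hr, sum_const, nsmul_eq_mul]
    have : (1 : ℝ) ≤ B.card := by exact_mod_cast hB.card_pos
    have := Nat.cast_nonneg (α := ℝ) r
    linarith
  · rintro _ ⟨R, hR, rfl⟩
    have e0 := le_sum_compl_of_feasible hR {0} (r := 1) (n := 3)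
      (by decide) (by decide) (by decide +kernel) rfl
    have e1 := le_sum_compl_of_feasible hR {1} (r := 1) (n := 3)
      (by decide) (by decide) (by decide +kernel) rfl
    have e2 := le_sum_compl_of_feasible hR {2} (r := 1) (n := 3)
      (by decide) (by decide) (by decide +kernel) rfl
    have t0 := le_sum_compl_of_feasible hR {0, 3, 5} (r := 2) (n := 2)
      (by decide) (by decide) (by decide +kernel) rfl
    have t1 := le_sum_compl_of_feasible hR {1, 4, 5} (r := 2) (n := 2)
      (by decide) (by decide) (by decide +kernel) rfl
    have t2 := le_sum_compl_of_feasible hR {2, 3, 4} (r := 2) (n := 2)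
      (by decide) (by decide) (by decide +kernel) rfl
    simp [Fin.sum_univ_six] at *
    linarith

/-- **Main theorem (helpers present): counter-example.** For the XOR source with
active set `A = {1,2,3}` (here `{0,1,2}`, so terminals `4,5,6` are helpers), the
mutual dependence upper bound is not tight: `C_SK(A) = h(M) − R_CO(A) < I(A)`. -/
theorem xor_counterexample_strict :
    Hent xorP (Finset.univ : Finset (Fin 6)) - RCO xorP ({0, 1, 2} : Finset (Fin 6))
      < IA xorP ({0, 1, 2} : Finset (Fin 6)) := by
  rw [Hent_xorP_univ]
  linarith [one_le_IA_xorP, nine_fourths_le_RCO_xorP]
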